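/- arXiv:1704.08934 — 2 statements merged into one kernel-verified Lean document; each statement's English description precedes it below -/
import Mathlib

section
/- For every n ≥ 6, every p-encoding with input variables x_1,…,x_n consists of at least 2n clauses; in particular S(n) ≥ 2n. -/
/-- A literal is a variable together with a polarity (`true` = positive). -/
abbrev Lit (V : Type) := V × Bool

/-- The negation of a literal. -/
def negLit {V : Type} (l : Lit V) : Lit V := (l.1, !l.2)

/-- A clause is a finite set of literals. -/
abbrev Clause (V : Type) := Finset (Lit V)

/-- A CNF formula is a finite set of clauses. -/
abbrev CNF (V : Type) := Finset (Clause V)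

/-- A clause proper contains no complementary pair of literals. -/
def IsClause {V : Type} [DecidableEq V] (C : Clause V) : Prop := ∀ l ∈ C, negLit l ∉ C

instance {V : Type} [DecidableEq V] (C : Clause V) : Decidable (IsClause C) := by
  unfold IsClause; infer_instance

/-- A CNF formula proper consists of proper clauses. -/
def IsCNF {V : Type} [DecidableEq V] (φ : CNF V) : Prop := ∀ C ∈ φ, IsClause C

/-- Satisfaction of a literal by an assignment. -/
def LitSat {V : Type} (α : V → Bool) (l : Lit V) : Prop := α l.1 = l.2

/-- Satisfaction of a clause by an assignment. -/
def ClauseSat {V : Type} (α : V → Bool) (C : Clause V) : Prop := ∃ l ∈ C, LitSat α l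

/-- Satisfaction of a CNF formula by an assignment. -/
def CnfSat {V : Type} (α : V → Bool) (φ : CNF V) : Prop := ∀ C ∈ φ, ClauseSat α C

/-- `UnitDerives φ C` : the clause `C` can be derived from `φ` by a series of unit
resolutions (each step resolves a derived unit clause with another derived clause). -/
inductive UnitDerives {V : Type} [DecidableEq V] (φ : CNF V) : Clause V → Prop
  | base {C : Clause V} (h : C ∈ φ) : UnitDerives φ C
  | step {l : Lit V} {C : Clause V} (h1 : UnitDerives φ {l})
      (h2 : UnitDerives φ C) (h3 : negLit l ∈ C) :
      UnitDerives φ (C.erase (negLit l))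

/-- The formula `φ ∧ l` (adding a unit clause). -/
def addUnit {V : Type} [DecidableEq V] (φ : CNF V) (l : Lit V) : CNF V :=
  insert {l} φ

/-- The formula `φ ∧ g₁ ∧ … ∧ g_p` (adding finitely many unit clauses). -/
def addUnits {V : Type} [DecidableEq V] (φ : CNF V) (L : Finset (Lit V)) : CNF V :=
  φ ∪ L.image (fun l => ({l} : Clause V))

/-- Variables: `n` input variables and `ℓ` auxiliary variables. -/
abbrev Var (n ℓ : ℕ) : Type := Sum (Fin n) (Fin ℓ)

/-- The literal on the `i`-th input variable with polarity `b`. -/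
def inLit {n ℓ : ℕ} (i : Fin n) (b : Bool) : Lit (Var n ℓ) := (Sum.inl i, b)

/-- A p-encoding: (P1) `φ ∧ x_i` is satisfiable for each input variable `x_i`, and
(P2) `φ ∧ x_i ⊢₁ ¬x_j` for all `i ≠ j`. -/
def IsPEncoding {n ℓ : ℕ} (φ : CNF (Var n ℓ)) : Prop :=
  IsCNF φ ∧
  (∀ i : Fin n, ∃ α : Var n ℓ → Bool, CnfSat α φ ∧ α (Sum.inl i) = true) ∧
  (∀ i j : Fin n, i ≠ j →
    UnitDerives (addUnit φ (inLit i true)) {inLit j false})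

/-- A p-encoding relative to a set `I` of input indices. -/
def IsPEncodingOn {n ℓ : ℕ} (φ : CNF (Var n ℓ)) (I : Finset (Fin n)) : Prop :=
  IsCNF φ ∧
  (∀ i ∈ I, ∃ α : Var n ℓ → Bool, CnfSat α φ ∧ α (Sum.inl i) = true) ∧
  (∀ i ∈ I, ∀ j ∈ I, i ≠ j →
    UnitDerives (addUnit φ (inLit i true)) {inLit j false})

/-- 2-CNF: every clause has at most two literals. -/
def Is2CNF {V : Type} (φ : CNF V) : Prop := ∀ C ∈ φ, C.card ≤ 2

/-- The set of possible sizes of p-encodings with `n` input variables. -/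
def pencSizes (n : ℕ) : Set ℕ :=
  {k | ∃ ℓ : ℕ, ∃ φ : CNF (Var n ℓ), IsPEncoding φ ∧ φ.card = k}

/-- `S n` : the minimum size of a p-encoding with `n` input variables. -/
noncomputable def S (n : ℕ) : ℕ := sInf (pencSizes n)

/-- The set of possible sizes of 2-CNF p-encodings with `n` input variables. -/
def penc2Sizes (n : ℕ) : Set ℕ :=
  {k | ∃ ℓ : ℕ, ∃ φ : CNF (Var n ℓ), IsPEncoding φ ∧ Is2CNF φ ∧ φ.card = k}

/-- `S₂ n` : the minimum size of a 2-CNF p-encoding with `n` input variables. -/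
noncomputable def S2 (n : ℕ) : ℕ := sInf (penc2Sizes n)

/-- `φ(x,y)` is an encoding of the boolean function `f(x)`. -/
def Encodes {n ℓ : ℕ} (φ : CNF (Var n ℓ)) (f : (Fin n → Bool) → Prop) : Prop :=
  IsCNF φ ∧
  ∀ α : Fin n → Bool, f α ↔ ∃ β : Fin ℓ → Bool, CnfSat (Sum.elim α β) φ

/-- Injection of literals on input variables into literals of the encoding. -/
def inLits {n ℓ : ℕ} (G : Finset (Lit (Fin n))) : Finset (Lit (Var n ℓ)) :=
  G.image (fun g => ((Sum.inl g.1 : Var n ℓ), g.2))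

/-- Propagation complete encoding of `f`: an encoding such that whenever
`f ∧ g₁ ∧ … ∧ g_p ⊨ h` for literals on input variables (`p ≥ 1`), unit propagation
from `φ ∧ g₁ ∧ … ∧ g_p` derives `h` or derives the empty clause. -/
def IsPCEncoding {n ℓ : ℕ} (φ : CNF (Var n ℓ)) (f : (Fin n → Bool) → Prop) : Prop :=
  Encodes φ f ∧
  ∀ G : Finset (Lit (Fin n)), G.Nonempty → ∀ h : Lit (Fin n),
    (∀ α : Fin n → Bool, f α → (∀ g ∈ G, α g.1 = g.2) → α h.1 = h.2) →
    (UnitDerives (addUnits φ (inLits G)) {((Sum.inl h.1 : Var n ℓ), h.2)} ∨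
     UnitDerives (addUnits φ (inLits G)) (∅ : Clause (Var n ℓ)))

/-- The "at most one" function. -/
def AMO (n : ℕ) (α : Fin n → Bool) : Prop :=
  (Finset.univ.filter fun i => α i = true).card ≤ 1

/-- The "exactly one" function. -/
def EXO (n : ℕ) (α : Fin n → Bool) : Prop :=
  (Finset.univ.filter fun i => α i = true).card = 1

/-- `Qset φ i` : the set of clauses of `φ` containing the literal `¬x_i`. -/
def Qset {n ℓ : ℕ} (φ : CNF (Var n ℓ)) (i : Fin n) : CNF (Var n ℓ) :=
  φ.filter (fun C => inLit i false ∈ C)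

/-- Regular form: for each `i`, `|Q_i| = 2`, clauses of `Q_i` contain no input variables
other than `x_i`, and all clauses of `Q_i` are binary. -/
def RegularForm {n ℓ : ℕ} (φ : CNF (Var n ℓ)) : Prop :=
  ∀ i : Fin n,
    (Qset φ i).card = 2 ∧
    (∀ C ∈ Qset φ i, ∀ j : Fin n, ∀ b : Bool, ((Sum.inl j : Var n ℓ), b) ∈ C → j = i) ∧
    (∀ C ∈ Qset φ i, C.card = 2)

/-- `C` is an implicate of `φ`. -/
def Implicate {V : Type} (φ : CNF V) (C : Clause V) : Prop :=
  ∀ α : V → Bool, CnfSat α φ → ClauseSat α C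

/-- `C` is a prime implicate of `φ`. -/
def PrimeImplicate {V : Type} (φ : CNF V) (C : Clause V) : Prop :=
  Implicate φ C ∧ ∀ C' : Clause V, C' ⊂ C → ¬ Implicate φ C'

/-- `φ` is prime: every clause of `φ` is a prime implicate of `φ`. -/
def IsPrime {V : Type} (φ : CNF V) : Prop := ∀ C ∈ φ, PrimeImplicate φ C

/-- The set of clauses of `φ` in which the auxiliary variable `y` occurs
(as a positive or negative literal). -/
def occursIn {n ℓ : ℕ} (φ : CNF (Var n ℓ)) (y : Fin ℓ) : CNF (Var n ℓ) :=
  φ.filter (fun C => ((Sum.inr y : Var n ℓ), true) ∈ C ∨ ((Sum.inr y : Var n ℓ), false) ∈ C)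

/-- The substitution `g₁ ← g₂` on a literal: `g₁ ↦ g₂`, `¬g₁ ↦ ¬g₂`,
all other literals unchanged. -/
def substLit {V : Type} [DecidableEq V] (g₁ g₂ : Lit V) (l : Lit V) : Lit V :=
  if l.1 = g₁.1 then (if l.2 = g₁.2 then g₂ else negLit g₂) else l

/-- The substitution `g₁ ← g₂` applied to a clause. -/
def substClause {V : Type} [DecidableEq V] (g₁ g₂ : Lit V) (C : Clause V) : Clause V :=
  C.image (substLit g₁ g₂)

/-- The formula `φ[g₁ ← g₂]`: apply the substitution to every clause and remove the
clauses that became tautological (i.e. contain a complementary pair of literals). -/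
def substCNF {V : Type} [DecidableEq V] (g₁ g₂ : Lit V) (φ : CNF V) : CNF V :=
  (φ.image (substClause g₁ g₂)).filter (fun C => IsClause C)

/-- `restrict φ ρ` : the formula `φ(ρ)` obtained from `φ` by the partial assignment
given by the set of literals `ρ` (clauses satisfied by `ρ` are removed, and falsified
literals are removed from the remaining clauses). -/
def restrict {V : Type} [DecidableEq V] (φ : CNF V) (ρ : Finset (Lit V)) : CNF V :=
  (φ.filter (fun C => ∀ l ∈ ρ, l ∉ C)).image (fun C => C.filter (fun l => negLit l ∉ ρ))

lemma negLit_negLit {V : Type} (l : Lit V) : negLit (negLit l) = l := by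
  simp [negLit]

lemma litSat_negLit {V : Type} (α : V → Bool) (l : Lit V) :
    LitSat α (negLit l) ↔ ¬ LitSat α l := by
  unfold LitSat negLit
  cases α l.1 <;> cases l.2 <;> simp

/-- Literals obtained by unit propagation from the clauses of `φ` and the literals in `T`. -/
inductive Propagates {V : Type} (φ : CNF V) (T : Set (Lit V)) : Lit V → Prop
  | hyp {l : Lit V} (h : l ∈ T) : Propagates φ T l
  | clause {C : Clause V} {l : Lit V} (hC : C ∈ φ) (hl : l ∈ C)
      (h : ∀ m ∈ C, m ≠ l → Propagates φ T (negLit m)) : Propagates φ T l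

namespace Propagates

lemma mono {V : Type} {φ ψ : CNF V} {T S : Set (Lit V)} {l : Lit V} (hφ : φ ⊆ ψ) (hT : T ⊆ S)
    (h : Propagates φ T l) : Propagates ψ S l := by
  induction h with
  | hyp h => exact .hyp (hT h)
  | clause hC hl _ ih => exact .clause (hφ hC) hl ih

lemma sound {V : Type} {φ : CNF V} {T : Set (Lit V)} {l : Lit V} {α : V → Bool}
    (hφ : CnfSat α φ) (hT : ∀ t ∈ T, LitSat α t) (h : Propagates φ T l) : LitSat α l := by
  induction h with
  | hyp h => exact hT _ h
  | clause hC hl _ ih =>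
    obtain ⟨m, hm, hs⟩ := hφ _ hC
    by_contra hn
    exact (litSat_negLit α m).1 (ih m hm (by rintro rfl; exact hn hs)) hs

/-- Clauses satisfied by an assumed literal are useless for unit propagation. -/
lemma filter_satisfied {V : Type} [DecidableEq V] {φ : CNF V} {T : Set (Lit V)} {t l : Lit V}
    {α : V → Bool} (hφ : CnfSat α φ) (hT : ∀ s ∈ T, LitSat α s) (ht : t ∈ T)
    (h : Propagates φ T l) : Propagates (φ.filter (t ∉ ·)) T l := by
  induction h with
  | hyp h => exact .hyp h
  | @clause C l hC hl hp ih =>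
    by_cases htC : t ∈ C
    · by_cases htl : t = l
      · exact .hyp (htl ▸ ht)
      · exact absurd (hT t ht) ((litSat_negLit α t).1 ((hp t htC htl).sound hφ hT))
    · exact .clause (Finset.mem_filter.2 ⟨hC, htC⟩) hl ih

end Propagates

lemma UnitDerives.propagates {V : Type} [DecidableEq V] {φ : CNF V} {g h : Lit V}
    (hd : UnitDerives (addUnit φ g) {h}) : Propagates φ {g} h := by
  have key : ∀ C, UnitDerives (addUnit φ g) C →
      ∀ l ∈ C, (∀ m ∈ C, m ≠ l → Propagates φ {g} (negLit m)) → Propagates φ {g} l := by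
    intro C hC
    induction hC with
    | base hC =>
      intro l hl hp
      rcases Finset.mem_insert.1 hC with rfl | hC
      · exact .hyp (Finset.mem_singleton.1 hl)
      · exact .clause hC hl hp
    | @step k C _ _ _ ih1 ih2 =>
      intro l hl hp
      refine ih2 l (Finset.mem_of_mem_erase hl) fun m hm hml => ?_
      by_cases hmk : m = negLit k
      · rw [hmk, negLit_negLit]
        exact ih1 k (Finset.mem_singleton_self k)
          fun m hm hne => absurd (Finset.mem_singleton.1 hm) hne
      · exact hp m (Finset.mem_erase.2 ⟨hmk, hm⟩) hml
  exact key _ hd h (Finset.mem_singleton_self h)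
    fun m hm hne => absurd (Finset.mem_singleton.1 hm) hne

/-- A p-encoding whose inputs are the literals `x i`, `i ∈ I`, under the assumptions `T`. -/
structure LitPEncoding {V ι : Type} (φ : CNF V) (x : ι → Lit V) (T : Set (Lit V))
    (I : Finset ι) : Prop where
  sat : ∀ i ∈ I, ∃ α : V → Bool, CnfSat α φ ∧ ∀ t ∈ insert (x i) T, LitSat α t
  prop : ∀ i ∈ I, ∀ j ∈ I, i ≠ j → Propagates φ (insert (x i) T) (negLit (x j))

namespace LitPEncoding

variable {V ι : Type} {φ : CNF V} {x : ι → Lit V}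
  {T : Set (Lit V)} {I : Finset ι}

lemma consistent (h : LitPEncoding φ x T I) {i : ι} (hi : i ∈ I) {l : Lit V}
    (h1 : Propagates φ (insert (x i) T) l)
    (h2 : Propagates φ (insert (x i) T) (negLit l)) : False := by
  obtain ⟨α, hα, hT⟩ := h.sat i hi
  exact (litSat_negLit α l).1 (h2.sound hα hT) (h1.sound hα hT)

lemma negLit_notMem (h : LitPEncoding φ x T I) {i : ι} (hi : i ∈ I) : negLit (x i) ∉ T :=
  fun hT => h.consistent hi (.hyp (Set.mem_insert _ _)) (.hyp (Set.mem_insert_of_mem _ hT))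

lemma ne_negLit [DecidableEq ι] (h : LitPEncoding φ x T I) (h3 : 3 ≤ I.card) {i j : ι} (hi : i ∈ I)
    (hj : j ∈ I) : negLit (x i) ≠ x j := by
  intro he
  obtain ⟨k, hk, hkn⟩ := Finset.exists_mem_notMem_of_card_lt_card
    (lt_of_le_of_lt (Finset.card_le_two (a := i) (b := j)) h3)
  simp only [Finset.mem_insert, Finset.mem_singleton, not_or] at hkn
  have h1 := h.prop k hk i hi hkn.1
  have h2 := h.prop k hk j hj hkn.2
  exact h.consistent hk h1 (he ▸ h2)

lemma exists_clause (h : LitPEncoding φ x T I) {i j : ι} (hi : i ∈ I) (hj : j ∈ I)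
    (hij : i ≠ j) (hne : negLit (x i) ≠ x j) :
    ∃ C ∈ φ, negLit (x i) ∈ C ∧
      ∀ m ∈ C, m ≠ negLit (x i) → Propagates φ (insert (x j) T) (negLit m) := by
  cases h.prop j hj i hi hij.symm with
  | hyp hT => exact ((Set.mem_insert_iff.1 hT).elim hne (h.negLit_notMem hi)).elim
  | clause hC hl hp => exact ⟨_, hC, hl, hp⟩

/-- Fixing the input literal `x i` to false. -/
lemma erase_input [DecidableEq V] [DecidableEq ι] (h : LitPEncoding φ x T I) {i : ι} (hi : i ∈ I) :
    LitPEncoding (φ.filter (negLit (x i) ∉ ·)) x (insert (negLit (x i)) T) (I.erase i) := by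
  have key : ∀ j ∈ I.erase i, ∃ α : V → Bool, CnfSat α φ ∧
      ∀ t ∈ insert (x j) (insert (negLit (x i)) T), LitSat α t := by
    intro j hj
    obtain ⟨hji, hj⟩ := Finset.mem_erase.1 hj
    obtain ⟨α, hα, hT⟩ := h.sat j hj
    refine ⟨α, hα, ?_⟩
    rintro t (rfl | rfl | ht)
    · exact hT _ (Set.mem_insert _ _)
    · exact (h.prop j hj i hi hji).sound hα hT
    · exact hT _ (Set.mem_insert_of_mem _ ht)
  refine ⟨fun j hj => ?_, fun j hj k hk hjk => ?_⟩
  · obtain ⟨α, hα, hT⟩ := key j hj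
    exact ⟨α, fun C hC => hα C (Finset.mem_of_mem_filter C hC), hT⟩
  · obtain ⟨α, hα, hT⟩ := key j hj
    refine Propagates.filter_satisfied hα hT (by simp) ?_
    exact (h.prop j (Finset.mem_of_mem_erase hj) k (Finset.mem_of_mem_erase hk) hjk).mono
      subset_rfl (Set.insert_subset_insert (Set.subset_insert _ _))

end LitPEncoding

lemma substLit_negLit {V : Type} [DecidableEq V] (g g' l : Lit V) :
    substLit g g' (negLit l) = negLit (substLit g g' l) := by
  obtain ⟨v, b⟩ := g
  obtain ⟨w, c⟩ := l
  by_cases hv : w = v <;> cases b <;> cases c <;> simp [substLit, negLit, hv]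

lemma litSat_substLit {V : Type} [DecidableEq V] {α : V → Bool} {g g' : Lit V}
    (h : LitSat α g ↔ LitSat α g') (l : Lit V) :
    LitSat α (substLit g g' l) ↔ LitSat α l := by
  unfold substLit
  split_ifs with h1 h2
  · rw [← h, Prod.ext h1 h2]
  · have hl : l = negLit g := Prod.ext h1 (by simpa [negLit] using Bool.eq_not_of_ne h2)
    rw [hl, litSat_negLit, litSat_negLit, h]
  · rfl

lemma substLit_self {V : Type} [DecidableEq V] (g g' : Lit V) : substLit g g' g = g' := by
  simp [substLit]

lemma substLit_of_ne {V : Type} [DecidableEq V] {g g' l : Lit V} (h1 : l ≠ g)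
    (h2 : l ≠ negLit g) : substLit g g' l = l := by
  unfold substLit
  split_ifs with h3 h4
  · exact absurd (Prod.ext h3 h4) h1
  · exact absurd (Prod.ext h3 (Bool.eq_not_of_ne h4) : l = negLit g) h2
  · rfl

namespace LitPEncoding

variable {V ι : Type} [DecidableEq V] [DecidableEq ι] {φ : CNF V} {x : ι → Lit V}
  {T : Set (Lit V)} {I : Finset ι}

/-- If `negLit (x i)` occurs only in the clause `C`, then propagation from `x i` starts by
deriving some literal `g` of `C`. -/
lemma exists_pivot (h : LitPEncoding φ x T I) (h3 : 3 ≤ I.card) {i : ι} (hi : i ∈ I)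
    {C : Clause V} (hC : ∀ D ∈ φ, negLit (x i) ∈ D → D = C) :
    ∃ g ∈ C, g ≠ x i ∧ g ≠ negLit (x i) ∧ Propagates φ (insert (x i) T) g ∧
      ∀ m ∈ C, m ≠ g → m ≠ negLit (x i) → Propagates (φ.erase C) T (negLit m) := by
  by_contra hcon
  push Not at hcon
  have key : ∀ l, Propagates φ (insert (x i) T) l → l = x i ∨ Propagates (φ.erase C) T l := by
    intro l hl
    induction hl with
    | hyp ht =>
      rcases Set.mem_insert_iff.1 ht with rfl | ht
      · exact .inl rfl
      · exact .inr (.hyp ht)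
    | @clause D l hD hl hp ih =>
      have hpre : ∀ m ∈ D, m ≠ l → m ≠ negLit (x i) →
          Propagates (φ.erase C) T (negLit m) := fun m hm hml hmi =>
        (ih m hm hml).resolve_left fun he => hmi (by rw [← he, negLit_negLit])
      by_cases hDC : D = C
      · subst hDC
        by_cases hlx : l = x i
        · exact .inl hlx
        have hU : Propagates φ (insert (x i) T) l := .clause hD hl hp
        by_cases hln : l = negLit (x i)
        · exact (h.consistent hi (.hyp (Set.mem_insert _ _)) (hln ▸ hU)).elim
        obtain ⟨m, hm, hml, hmi, hn⟩ := hcon l hl hlx hln hU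
        exact absurd (hpre m hm hml hmi) hn
      · refine .inr (.clause (Finset.mem_erase.2 ⟨hDC, hD⟩) hl fun m hm hml => ?_)
        exact hpre m hm hml fun he => hDC (hC D hD (he ▸ hm))
  obtain ⟨j, hj, hji⟩ := Finset.exists_mem_ne (show 1 < I.card by omega) i
  rcases key _ (h.prop i hi j hj hji.symm) with he | hp
  · exact h.ne_negLit h3 hj hi he
  · exact h.consistent hj (.hyp (Set.mem_insert _ _))
      (hp.mono (Finset.erase_subset _ _) (Set.subset_insert _ _))

/-- If the negation of an input literal occurs in at most one clause, the input can be
substituted by another literal so that this clause becomes redundant. -/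
lemma exists_card_lt (h : LitPEncoding φ x T I) (h3 : 3 ≤ I.card) {i : ι} (hi : i ∈ I)
    (hQ : (φ.filter (negLit (x i) ∈ ·)).card ≤ 1) :
    ∃ (φ' : CNF V) (x' : ι → Lit V) (T' : Set (Lit V)),
      LitPEncoding φ' x' T' I ∧ φ'.card < φ.card := by
  obtain ⟨j₀, hj₀, hji₀⟩ := Finset.exists_mem_ne (show 1 < I.card by omega) i
  obtain ⟨C, hCφ, hCi, -⟩ := h.exists_clause hi hj₀ hji₀.symm (h.ne_negLit h3 hi hj₀)
  have hC : ∀ D ∈ φ, negLit (x i) ∈ D → D = C := fun D hD hDi =>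
    Finset.card_le_one.1 hQ D (Finset.mem_filter.2 ⟨hD, hDi⟩) C
      (Finset.mem_filter.2 ⟨hCφ, hCi⟩)
  obtain ⟨g, hg, hgx, hgn, hgU, hgC⟩ := h.exists_pivot h3 hi hC
  set σ := substLit (x i) g with hσ
  have hσx : σ (x i) = g := substLit_self _ _
  have hσg : σ g = g := substLit_of_ne hgx hgn
  have hσn : ∀ l, σ (negLit l) = negLit (σ l) := substLit_negLit _ _
  have transfer : ∀ k ∈ I, ∀ l, Propagates φ (insert (x k) T) l →
      Propagates ((φ.erase C).image (substClause (x i) g)) (insert (σ (x k)) (σ '' T))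
        (σ l) := by
    have base : ∀ {S : Set (Lit V)} {D : Clause V} {l : Lit V}, D ∈ φ.erase C → l ∈ D →
        (∀ m ∈ D, m ≠ l → Propagates ((φ.erase C).image (substClause (x i) g)) S
          (σ (negLit m))) →
        Propagates ((φ.erase C).image (substClause (x i) g)) S (σ l) := by
      intro S D l hD hl hp
      refine .clause (Finset.mem_image_of_mem _ hD) (Finset.mem_image_of_mem _ hl) ?_
      intro m' hm' hne
      obtain ⟨m, hm, rfl⟩ := Finset.mem_image.1 hm'
      exact hσn m ▸ hp m hm (by rintro rfl; exact hne rfl)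
    intro k hk l hl
    induction hl with
    | hyp ht =>
      rcases Set.mem_insert_iff.1 ht with rfl | ht
      · exact .hyp (Set.mem_insert _ _)
      · exact .hyp (Set.mem_insert_of_mem _ (Set.mem_image_of_mem _ ht))
    | @clause D l hD hl hp ih =>
      by_cases hDC : D = C
      · subst hDC
        by_cases hlg : l = g
        · have := ih _ hCi (by rw [hlg]; exact hgn.symm)
          rw [negLit_negLit, hσx] at this
          rwa [hlg, hσg]
        by_cases hln : l = negLit (x i)
        · have := ih g hg (Ne.symm hlg)
          rw [hσn, hσg] at this
          rwa [hln, hσn, hσx]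
        · exact (h.consistent hk (.clause hD hl hp) ((hgC l hl hlg hln).mono
            (Finset.erase_subset _ _) (Set.subset_insert _ _))).elim
      · exact base (Finset.mem_erase.2 ⟨hDC, hD⟩) hl ih
  refine ⟨(φ.erase C).image (substClause (x i) g), σ ∘ x, σ '' T, ⟨fun k hk => ?_,
    fun j hj k hk hjk => ?_⟩, ?_⟩
  · obtain ⟨α, hα, hT⟩ := h.sat k hk
    have hiff : LitSat α (x i) ↔ LitSat α g := by
      by_cases hki : k = i
      · subst hki
        exact iff_of_true (hT _ (Set.mem_insert _ _)) (hgU.sound hα hT)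
      · obtain ⟨D, hD, hDi, hp⟩ :=
          h.exists_clause hi hk (Ne.symm hki) (h.ne_negLit h3 hi hk)
        obtain rfl := hC D hD hDi
        exact iff_of_false
          ((litSat_negLit _ _).1 ((h.prop k hk i hi hki).sound hα hT))
          ((litSat_negLit _ _).1 ((hp g hg hgn).sound hα hT))
    refine ⟨α, fun D' hD' => ?_, ?_⟩
    · obtain ⟨D, hD, rfl⟩ := Finset.mem_image.1 hD'
      obtain ⟨l, hl, hs⟩ := hα D (Finset.mem_of_mem_erase hD)
      exact ⟨_, Finset.mem_image_of_mem _ hl, (litSat_substLit hiff l).2 hs⟩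
    · rintro t (rfl | ⟨s, hs, rfl⟩)
      · exact (litSat_substLit hiff _).2 (hT _ (Set.mem_insert _ _))
      · exact (litSat_substLit hiff _).2 (hT _ (Set.mem_insert_of_mem _ hs))
  · exact hσn (x k) ▸ transfer j hj _ (h.prop j hj k hk hjk)
  · exact lt_of_le_of_lt Finset.card_image_le (Finset.card_erase_lt_of_mem hCφ)

theorem le_card (h : LitPEncoding φ x T I) (h3 : 3 ≤ I.card) :
    min (2 * I.card) (3 * I.card - 6) ≤ φ.card := by
  induction hN : φ.card using Nat.strong_induction_on generalizing φ x T I with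
  | _ N IH =>
  subst hN
  by_cases hsmall : ∃ i ∈ I, (φ.filter (negLit (x i) ∈ ·)).card ≤ 1
  · obtain ⟨i, hi, hQ⟩ := hsmall
    obtain ⟨φ', x', T', h', hlt⟩ := h.exists_card_lt h3 hi hQ
    exact (IH _ hlt h' h3 rfl).trans hlt.le
  push Not at hsmall
  have hsplit (i : ι) := Finset.card_filter_add_card_filter_not (s := φ) (negLit (x i) ∈ ·)
  have hcard {i : ι} (hi : i ∈ I) := Finset.card_erase_of_mem hi
  by_cases h4 : I.card = 3
  · obtain ⟨i, hi⟩ : I.Nonempty := Finset.card_pos.1 (by omega)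
    obtain ⟨j, hj, k, hk, hjk⟩ := Finset.one_lt_card.1 (show 1 < (I.erase i).card by
      rw [hcard hi]; omega)
    obtain ⟨C, hC, -⟩ := (h.erase_input hi).exists_clause hj hk hjk
      (h.ne_negLit h3 (Finset.mem_of_mem_erase hj) (Finset.mem_of_mem_erase hk))
    have := Finset.card_pos.2 ⟨C, hC⟩
    have := hsplit i
    have := hsmall i hi
    omega
  by_cases hbig : ∃ i ∈ I, 3 ≤ (φ.filter (negLit (x i) ∈ ·)).card
  · obtain ⟨i, hi, hQ⟩ := hbig
    have := hsplit i
    have := IH _ (by omega) (h.erase_input hi) (by rw [hcard hi]; omega) rfl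
    rw [hcard hi] at this
    omega
  push Not at hbig
  by_cases hdis : ∀ i ∈ I, ∀ j ∈ I, i ≠ j →
      Disjoint (φ.filter (negLit (x i) ∈ ·)) (φ.filter (negLit (x j) ∈ ·))
  · calc min (2 * I.card) (3 * I.card - 6) ≤ I.card * 2 := by omega
      _ ≤ ∑ i ∈ I, (φ.filter (negLit (x i) ∈ ·)).card :=
        by
        simpa using Finset.card_nsmul_le_sum I
          (fun i => (φ.filter (negLit (x i) ∈ ·)).card) 2 hsmall
      _ = (I.biUnion fun i => φ.filter (negLit (x i) ∈ ·)).card :=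
        (Finset.card_biUnion hdis).symm
      _ ≤ φ.card := Finset.card_le_card
        (Finset.biUnion_subset.2 fun i _ => Finset.filter_subset _ _)
  push Not at hdis
  obtain ⟨i, hi, j, hj, hij, hdis⟩ := hdis
  obtain ⟨B, hBi, hBj⟩ := Finset.not_disjoint_iff.1 hdis
  have hQj : ((φ.filter (negLit (x i) ∉ ·)).filter (negLit (x j) ∈ ·)).card ≤ 1 := by
    have hlt : ((φ.filter (negLit (x i) ∉ ·)).filter (negLit (x j) ∈ ·)).card <
        (φ.filter (negLit (x j) ∈ ·)).card := by
      refine Finset.card_lt_card (Finset.ssubset_iff_of_subset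
        (Finset.filter_subset_filter _ (Finset.filter_subset _ _)) |>.2 ⟨B, hBj, fun hB => ?_⟩)
      exact (Finset.mem_filter.1 (Finset.mem_of_mem_filter B hB)).2 (Finset.mem_filter.1 hBi).2
    have := hbig j hj
    omega
  have hI : 3 ≤ (I.erase i).card := by rw [hcard hi]; omega
  obtain ⟨φ', x', T', h', hlt⟩ := (h.erase_input hi).exists_card_lt hI
    (Finset.mem_erase.2 ⟨hij.symm, hj⟩) hQj
  have := hsplit i
  have := hsmall i hi
  have := IH _ (by omega) h' hI rfl
  rw [hcard hi] at this
  omega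

end LitPEncoding

lemma IsPEncoding.litPEncoding {n ℓ : ℕ} {φ : CNF (Var n ℓ)} (h : IsPEncoding φ) :
    LitPEncoding φ (fun i => inLit i true) ∅ Finset.univ := by
  refine ⟨fun i _ => ?_, fun i _ j _ hij => ?_⟩
  · obtain ⟨α, hα, hi⟩ := h.2.1 i
    exact ⟨α, hα, by simpa [LitSat, inLit] using hi⟩
  · simpa [negLit, inLit] using (h.2.2 i j hij).propagates

/-- The pairwise encoding shows that p-encodings exist. -/
lemma pencSizes_nonempty (n : ℕ) : (pencSizes n).Nonempty := by
  let φ : CNF (Var n 0) := (Finset.univ : Finset (Fin n)).offDiag.image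
    fun p => {inLit p.1 false, inLit p.2 false}
  refine ⟨φ.card, 0, φ, ⟨fun C hC l hl => ?_, fun i => ?_, fun i j hij => ?_⟩, rfl⟩
  · obtain ⟨p, -, rfl⟩ := Finset.mem_image.1 hC
    simp only [Finset.mem_insert, Finset.mem_singleton] at hl
    rcases hl with rfl | rfl <;> simp [negLit, inLit]
  · refine ⟨fun v => decide (v = Sum.inl i), fun C hC => ?_, by simp⟩
    obtain ⟨p, hp, rfl⟩ := Finset.mem_image.1 hC
    have hne : p.1 ≠ p.2 := (Finset.mem_offDiag.1 hp).2.2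
    by_cases h1 : p.1 = i
    · exact ⟨inLit p.2 false, by simp, by simp [LitSat, inLit, ← h1, hne.symm]⟩
    · exact ⟨inLit p.1 false, by simp, by simp [LitSat, inLit, h1]⟩
  · have h1 : UnitDerives (addUnit φ (inLit i true)) {inLit i true} :=
      .base (Finset.mem_insert_self _ _)
    have h2 : UnitDerives (addUnit φ (inLit i true)) {inLit i false, inLit j false} :=
      .base (Finset.mem_insert_of_mem (Finset.mem_image.2 ⟨(i, j), by simp [hij], rfl⟩))
    have h3 := h1.step h2 (by simp [negLit, inLit])
    have he : ({inLit i false, inLit j false} : Clause (Var n 0)).erase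
        (negLit (inLit i true)) = {inLit j false} :=
      Finset.erase_insert (by simp [inLit, hij])
    exact he ▸ h3

/-- For every n ≥ 6, every p-encoding with n input variables consists of
at least 2n clauses; in particular S(n) ≥ 2n. -/
theorem penc_two_n_lower_bound (n : ℕ) (hn : 6 ≤ n) :
    (∀ ℓ : ℕ, ∀ φ : CNF (Var n ℓ), IsPEncoding φ → 2 * n ≤ φ.card) ∧
    2 * n ≤ S n := by
  have key : ∀ ℓ : ℕ, ∀ φ : CNF (Var n ℓ), IsPEncoding φ → 2 * n ≤ φ.card := by
    intro ℓ φ h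
    have hle := h.litPEncoding.le_card (by simp; omega)
    rw [Finset.card_univ, Fintype.card_fin] at hle
    omega
  refine ⟨key, le_csInf (pencSizes_nonempty n) ?_⟩
  rintro k ⟨ℓ, φ, h, rfl⟩
  exact key ℓ φ h
end

section
/- There exists a constant C such that for every n ≥ 3 there is a 2-CNF propagation complete encoding of AMO_n of size at most 2n + 4√n + C·n^{1/4}. -/
open Finset

section Renaming

variable {V W : Type}

/-- Renaming the variable of a literal. -/
def renameLit (f : V → W) (l : Lit V) : Lit W := (f l.1, l.2)

theorem renameLit_injective {f : V → W} (hf : Function.Injective f) :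
    Function.Injective (renameLit f) := by
  rintro ⟨a, p⟩ ⟨b, q⟩ h
  simp only [renameLit, Prod.mk.injEq] at h
  exact Prod.ext (hf h.1) h.2

theorem renameLit_negLit (f : V → W) (l : Lit V) :
    renameLit f (negLit l) = negLit (renameLit f l) := rfl

variable [DecidableEq W]

/-- Renaming the variables of a clause. -/
def renameClause (f : V → W) (C : Clause V) : Clause W := C.image (renameLit f)

/-- Renaming the variables of a formula. -/
def renameCNF (f : V → W) (φ : CNF V) : CNF W := φ.image (renameClause f)

theorem renameClause_singleton (f : V → W) (l : Lit V) :
    renameClause f {l} = {renameLit f l} := image_singleton _ _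

variable [DecidableEq V]

theorem UnitDerives.rename {f : V → W} (hf : Function.Injective f) {φ : CNF V} {C : Clause V}
    (h : UnitDerives φ C) : UnitDerives (renameCNF f φ) (renameClause f C) := by
  induction h with
  | base h => exact .base (mem_image_of_mem _ h)
  | @step l C _ _ h3 ih1 ih2 =>
    rw [renameClause_singleton] at ih1
    have := UnitDerives.step ih1 ih2 (by
      rw [← renameLit_negLit]; exact mem_image_of_mem _ h3)
    rwa [← renameLit_negLit, renameClause, ← image_erase (renameLit_injective hf)] at this

theorem UnitDerives.trans {φ ψ : CNF V} {C : Clause V} (h : UnitDerives φ C)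
    (hψ : ∀ D ∈ φ, UnitDerives ψ D) : UnitDerives ψ C := by
  induction h with
  | base h => exact hψ _ h
  | step _ _ h3 ih1 ih2 => exact .step ih1 ih2 h3

theorem UnitDerives.resolve_pair {φ : CNF V} {a b : Lit V} (hab : a ≠ b)
    (h1 : UnitDerives φ {negLit a}) (h2 : {a, b} ∈ φ) : UnitDerives φ {b} := by
  have hn : negLit (negLit a) = a := by simp [negLit]
  have := UnitDerives.step h1 (.base h2) (by simp [hn])
  rwa [hn, erase_insert (by simpa using hab)] at this

theorem UnitDerives.empty_of_complementary {φ : CNF V} {a : Lit V}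
    (h1 : UnitDerives φ {negLit a}) (h2 : UnitDerives φ {a}) : UnitDerives φ ∅ := by
  have hn : negLit (negLit a) = a := by simp [negLit]
  have := UnitDerives.step h1 h2 (by simp [hn])
  rwa [hn, erase_singleton] at this

theorem UnitDerives.sound {φ : CNF V} {C : Clause V} (h : UnitDerives φ C)
    {α : V → Bool} (hα : CnfSat α φ) : ClauseSat α C := by
  induction h with
  | base h => exact hα _ h
  | @step l C _ _ _ ih1 ih2 =>
    obtain ⟨a, ha, has⟩ := ih1
    obtain rfl := mem_singleton.1 ha
    obtain ⟨b, hb, hbs⟩ := ih2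
    refine ⟨b, mem_erase.2 ⟨?_, hb⟩, hbs⟩
    rintro rfl
    simp only [LitSat, negLit] at has hbs
    rw [has] at hbs
    simp at hbs

end Renaming

/-- A 2-CNF formula which has a model extending each assignment of weight at most one, and in
which each input variable propagates the negations of all the others. -/
structure IsAmoEncoding {n ℓ : ℕ} (φ : CNF (Var n ℓ)) : Prop where
  isCNF : IsCNF φ
  is2CNF : Is2CNF φ
  exists_model : ∀ o : Option (Fin n), ∃ α : Var n ℓ → Bool,
    CnfSat α φ ∧ ∀ i, α (Sum.inl i) = decide (o = some i)
  propagates : ∀ i j : Fin n, i ≠ j → UnitDerives (addUnit φ (inLit i true)) {inLit j false}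

theorem amo_iff {n : ℕ} (α : Fin n → Bool) :
    AMO n α ↔ ∀ i j, α i = true → α j = true → i = j := by
  simp [AMO, card_le_one]
  grind

theorem amo_single {n : ℕ} (o : Option (Fin n)) : AMO n fun i => decide (o = some i) := by
  rw [amo_iff]
  simp only [decide_eq_true_eq]
  rintro i j rfl h
  exact Option.some.inj h

theorem AMO.exists_single {n : ℕ} {α : Fin n → Bool} (h : AMO n α) :
    ∃ o : Option (Fin n), ∀ i, α i = decide (o = some i) := by
  rw [amo_iff] at h
  by_cases hα : ∃ i, α i = true
  · obtain ⟨i, hi⟩ := hα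
    refine ⟨some i, fun j => ?_⟩
    by_cases hij : i = j
    · simp [← hij, hi]
    · have : α j ≠ true := fun hj => hij (h i j hi hj)
      simp [hij, this]
  · push Not at hα
    exact ⟨none, fun i => by simpa using hα i⟩

theorem IsAmoEncoding.encodes {n ℓ : ℕ} {φ : CNF (Var n ℓ)} (h : IsAmoEncoding φ) :
    Encodes φ (AMO n) := by
  refine ⟨h.isCNF, fun α => ⟨fun hα => ?_, ?_⟩⟩
  · obtain ⟨o, ho⟩ := hα.exists_single
    obtain ⟨γ, hγ, hγo⟩ := h.exists_model o
    refine ⟨fun k => γ (Sum.inr k), ?_⟩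
    have : Sum.elim α (fun k => γ (Sum.inr k)) = γ := by
      funext v
      cases v with
      | inl i => simp [ho, hγo]
      | inr k => rfl
    rwa [this]
  · rintro ⟨β, hβ⟩
    rw [amo_iff]
    intro i j hi hj
    by_contra hij
    have hs : CnfSat (Sum.elim α β) (addUnit φ (inLit i true)) := by
      intro C hC
      rcases mem_insert.1 hC with rfl | hC
      · exact ⟨_, mem_singleton_self _, hi⟩
      · exact hβ C hC
    obtain ⟨l, hl, hls⟩ := (h.propagates i j hij).sound hs
    obtain rfl := mem_singleton.1 hl
    simp [LitSat, inLit, hj] at hls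

theorem IsAmoEncoding.isPCEncoding {n ℓ : ℕ} {φ : CNF (Var n ℓ)} (h : IsAmoEncoding φ) :
    IsPCEncoding φ (AMO n) := by
  refine ⟨h.encodes, fun G _ l hl => ?_⟩
  have unit : ∀ g ∈ G, UnitDerives (addUnits φ (inLits G)) {inLit g.1 g.2} := fun g hg =>
    .base (mem_union_right _ (mem_image_of_mem _ (mem_image_of_mem _ hg)))
  have prop : ∀ i, (i, true) ∈ G → ∀ j, i ≠ j →
      UnitDerives (addUnits φ (inLits G)) {inLit j false} := by
    intro i hi j hij
    refine (h.propagates i j hij).trans fun D hD => ?_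
    rcases mem_insert.1 hD with rfl | hD
    · exact unit _ hi
    · exact .base (mem_union_left _ hD)
  by_cases hpos : ∃ i, (i, true) ∈ G
  · obtain ⟨i, hi⟩ := hpos
    by_cases hcons : ∀ g ∈ G, decide (some i = some g.1) = g.2
    · left
      have hv := hl _ (amo_single (some i)) hcons
      obtain ⟨j, b⟩ := l
      by_cases hij : i = j
      · subst hij
        simp only [decide_true] at hv
        subst hv
        exact unit _ hi
      · have : b = false := by simpa [hij] using hv.symm
        subst this
        exact prop i hi j hij
    · right
      push Not at hcons
      obtain ⟨⟨j, b⟩, hg, hgne⟩ := hcons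
      by_cases hij : i = j
      · subst hij
        have : b = false := by simpa using hgne
        subst this
        exact .empty_of_complementary (a := inLit i true) (unit _ hg) (unit _ hi)
      · have : b = true := by simpa [hij] using hgne
        subst this
        exact .empty_of_complementary (a := inLit j true) (prop i hi j hij) (unit _ hg)
  · left
    push Not at hpos
    have hneg : ∀ g ∈ G, g.2 = false := by
      rintro ⟨i, b⟩ hg
      cases b
      · rfl
      · exact absurd hg (hpos i)
    obtain ⟨j, b⟩ := l
    have hb := hl _ (amo_single none) fun g hg => by simp [hneg g hg]
    simp only [reduceCtorEq, decide_false] at hb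
    subst hb
    by_cases hj : (j, false) ∈ G
    · exact unit _ hj
    · have := hl _ (amo_single (some j)) fun g hg => by
        have hne : j ≠ g.1 := by
          rintro rfl
          apply hj
          rw [← hneg g hg]
          exact hg
        simp [hneg g hg, hne]
      simp at this

/-- The formula consisting of all clauses `¬x_i ∨ ¬x_j` is an encoding. -/
theorem exists_isAmoEncoding_card_le_sq (n : ℕ) :
    ∃ ℓ : ℕ, ∃ φ : CNF (Var n ℓ), IsAmoEncoding φ ∧ φ.card ≤ n * n := by
  let φ : CNF (Var n 0) := (univ : Finset (Fin n)).offDiag.image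
    fun p => {inLit p.1 false, inLit p.2 false}
  have mem : ∀ C, C ∈ φ ↔ ∃ i j, i ≠ j ∧ {inLit i false, inLit j false} = C := by
    simp [φ]
  refine ⟨0, φ, ⟨?_, ?_, fun o => ?_, fun i j hij => ?_⟩, ?_⟩
  · intro C hC
    obtain ⟨i, j, -, rfl⟩ := (mem C).1 hC
    simp [IsClause, negLit, inLit]
  · intro C hC
    obtain ⟨i, j, -, rfl⟩ := (mem C).1 hC
    exact card_le_two
  · refine ⟨Sum.elim (fun i => decide (o = some i)) (fun _ => false), ?_, fun i => rfl⟩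
    intro C hC
    obtain ⟨i, j, hij, rfl⟩ := (mem C).1 hC
    by_cases hi : o = some i
    · exact ⟨inLit j false, by simp, by simp [LitSat, inLit, hi, hij]⟩
    · exact ⟨inLit i false, by simp, by simp [LitSat, inLit, hi]⟩
  · refine .resolve_pair (a := inLit i false) (by simp [inLit, hij])
      (.base (mem_insert_self _ _)) (mem_insert_of_mem ?_)
    exact (mem _).2 ⟨i, j, hij, rfl⟩
  · refine card_image_le.trans ?_
    simp [offDiag_card]

/-- The product construction: index the inputs by pairs (row, column), and bound the number of
rows and the number of columns used by two copies of a smaller encoding. -/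
theorem IsAmoEncoding.product {m n ℓ : ℕ} {φ : CNF (Var m ℓ)} (h : IsAmoEncoding φ)
    (hn : n ≤ m ^ 2) :
    ∃ ℓ' : ℕ, ∃ ψ : CNF (Var n ℓ'), IsAmoEncoding ψ ∧ ψ.card ≤ 2 * n + 2 * φ.card := by
  obtain ⟨c⟩ : Nonempty (Fin n ↪ (Bool → Fin m)) :=
    Function.Embedding.nonempty_of_card_le (by simpa using hn)
  let e := Fintype.equivFin (Var m ℓ × Bool)
  let u : Bool → Var m ℓ → Var n (Fintype.card (Var m ℓ × Bool)) :=
    fun b v => Sum.inr (e (v, b))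
  have hu : ∀ b, Function.Injective (u b) := fun b v w hvw => by
    simpa [u] using hvw
  let link : Bool → Fin n → Clause (Var n (Fintype.card (Var m ℓ × Bool))) :=
    fun b i => {inLit i false, (u b (Sum.inl (c i b)), true)}
  let ψ : CNF (Var n (Fintype.card (Var m ℓ × Bool))) :=
    univ.biUnion fun b => renameCNF (u b) φ ∪ univ.image (link b)
  have mem : ∀ C, C ∈ ψ ↔ ∃ b, (∃ D ∈ φ, renameClause (u b) D = C) ∨ ∃ i, link b i = C := by
    intro C
    simp only [ψ, renameCNF, mem_biUnion, mem_union, mem_image, mem_univ, true_and]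
  refine ⟨_, ψ, ⟨?_, ?_, fun o => ?_, fun i j hij => ?_⟩, ?_⟩
  · intro C hC
    obtain ⟨b, ⟨D, hD, rfl⟩ | ⟨i, rfl⟩⟩ := (mem C).1 hC
    · intro l hl hnl
      obtain ⟨a, ha, rfl⟩ := mem_image.1 hl
      rw [← renameLit_negLit] at hnl
      obtain ⟨a', ha', haa⟩ := mem_image.1 hnl
      rw [renameLit_injective (hu b) haa] at ha'
      exact h.isCNF D hD a ha ha'
    · simp [link, IsClause, negLit, inLit, u]
  · intro C hC
    obtain ⟨b, ⟨D, hD, rfl⟩ | ⟨i, rfl⟩⟩ := (mem C).1 hC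
    · exact card_image_le.trans (h.is2CNF D hD)
    · exact card_le_two
  · choose α hα hαi using fun b => h.exists_model (o.map fun i => c i b)
    refine ⟨Sum.elim (fun i => decide (o = some i)) fun k => α (e.symm k).2 (e.symm k).1,
      ?_, fun i => rfl⟩
    intro C hC
    obtain ⟨b, ⟨D, hD, rfl⟩ | ⟨i, rfl⟩⟩ := (mem C).1 hC
    · obtain ⟨l, hl, hls⟩ := hα b D hD
      exact ⟨_, mem_image_of_mem _ hl, by simpa [LitSat, renameLit, u] using hls⟩
    · by_cases hi : o = some i
      · exact ⟨(u b (Sum.inl (c i b)), true), by simp [link], by simp [LitSat, u, hαi, hi]⟩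
      · exact ⟨inLit i false, by simp [link], by simp [LitSat, inLit, hi]⟩
  · obtain ⟨b, hb⟩ := Function.ne_iff.1 (c.injective.ne hij)
    have hlink : ∀ k, link b k ∈ addUnit ψ (inLit i true) := fun k =>
      mem_insert_of_mem ((mem _).2 ⟨b, .inr ⟨k, rfl⟩⟩)
    have hrow : UnitDerives (addUnit ψ (inLit i true)) {(u b (Sum.inl (c i b)), true)} :=
      .resolve_pair (a := inLit i false) (by simp [inLit])
        (.base (mem_insert_self _ _)) (hlink i)
    have hcol : UnitDerives (addUnit ψ (inLit i true)) {(u b (Sum.inl (c j b)), false)} := by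
      have := (h.propagates _ _ hb).rename (hu b)
      rw [renameClause_singleton] at this
      refine this.trans fun D hD => ?_
      obtain ⟨E, hE, rfl⟩ := mem_image.1 hD
      rcases mem_insert.1 hE with rfl | hE
      · rw [renameClause_singleton]
        exact hrow
      · exact .base (mem_insert_of_mem ((mem _).2 ⟨b, .inl ⟨E, hE, rfl⟩⟩))
    refine .resolve_pair (a := (u b (Sum.inl (c j b)), true)) (by simp [inLit]) hcol ?_
    rw [pair_comm]
    exact hlink j
  · have hcard : ∀ b, (renameCNF (u b) φ ∪ univ.image (link b)).card ≤ φ.card + n := fun b =>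
      (card_union_le _ _).trans
        (add_le_add card_image_le (card_image_le.trans (by simp)))
    refine card_biUnion_le.trans ((sum_le_sum fun b _ => hcard b).trans ?_)
    simp
    omega

theorem exists_isAmoEncoding_card_le_linear (n : ℕ) :
    ∃ ℓ : ℕ, ∃ φ : CNF (Var n ℓ), IsAmoEncoding φ ∧ φ.card ≤ 16 * n := by
  induction n using Nat.strong_induction_on with
  | _ n ih =>
    by_cases hn : n < 16
    · obtain ⟨ℓ, φ, h, hc⟩ := exists_isAmoEncoding_card_le_sq n
      exact ⟨ℓ, φ, h, hc.trans (Nat.mul_le_mul_right n hn.le)⟩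
    · have hs : 4 ≤ n.sqrt := Nat.le_sqrt.2 (by omega)
      have hs' : n.sqrt * n.sqrt ≤ n := Nat.sqrt_le n
      obtain ⟨ℓ, φ, h, hc⟩ := ih (n.sqrt + 1) (by nlinarith)
      obtain ⟨ℓ', ψ, h', hc'⟩ := h.product (Nat.lt_succ_sqrt' n).le
      exact ⟨ℓ', ψ, h', by nlinarith⟩

/-- There is a constant C such that for every n ≥ 3 there is a 2-CNF
propagation complete encoding of AMO_n of size at most 2n + 4√n + C·n^{1/4}. -/
theorem product_encoding_upper_bound :
    ∃ C : ℝ, ∀ n : ℕ, 3 ≤ n →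
      ∃ ℓ : ℕ, ∃ φ : CNF (Var n ℓ), IsPCEncoding φ (AMO n) ∧ Is2CNF φ ∧
        (φ.card : ℝ) ≤ 2 * (n : ℝ) + 4 * Real.sqrt n + C * (n : ℝ) ^ ((1 : ℝ) / 4) := by
  refine ⟨196, fun n hn => ?_⟩
  set m := n.sqrt + 1 with hm
  obtain ⟨ℓ₀, φ₀, h₀, hc₀⟩ := exists_isAmoEncoding_card_le_linear (m.sqrt + 1)
  obtain ⟨ℓ₁, φ₁, h₁, hc₁⟩ := h₀.product (Nat.lt_succ_sqrt' m).le
  obtain ⟨ℓ, φ, h, hc⟩ := h₁.product (Nat.lt_succ_sqrt' n).le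
  refine ⟨ℓ, φ, h.isPCEncoding, h.is2CNF, ?_⟩
  have hcard : (φ.card : ℝ) ≤ 2 * n + 4 * m + 64 * (m.sqrt + 1) := by
    have : φ.card ≤ 2 * n + 4 * m + 64 * (m.sqrt + 1) := by omega
    exact_mod_cast this
  have hn1 : (1 : ℝ) ≤ n := by exact_mod_cast (by omega : 1 ≤ n)
  set t : ℝ := (n : ℝ) ^ ((1 : ℝ) / 4) with ht
  have ht1 : 1 ≤ t := Real.one_le_rpow hn1 (by norm_num)
  have ht2 : t ^ 2 = Real.sqrt n := by
    rw [Real.sqrt_eq_rpow, ht, ← Real.rpow_natCast, ← Real.rpow_mul (by positivity)]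
    norm_num
  have hm' : (m : ℝ) ≤ Real.sqrt n + 1 := by
    rw [hm]
    push_cast
    linarith [Real.nat_sqrt_le_real_sqrt (a := n)]
  have hms : (m.sqrt : ℝ) ≤ 2 * t := by
    have : (m.sqrt : ℝ) * m.sqrt ≤ m := by exact_mod_cast Nat.sqrt_le m
    nlinarith
  linarith
end
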